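/- Let α > 0 and H ∈ (1/2, 1) be real numbers. Then sup_{n ≥ 1} e^{−2α n} ∫₀^n ∫₀^n (e^{α u} − 1)(e^{α v} − 1) |u−v|^{2H−2} du dv < ∞; indeed for every n > 0 one has e^{−2α n} ∫₀^n ∫₀^n (e^{α u} − 1)(e^{α v} − 1) |u−v|^{2H−2} du dv ≤ ∫₀^∞ ∫₀^∞ e^{−α u} e^{−α v} |u−v|^{2H−2} du dv, and the right-hand side is finite. -/

import Mathlib

open Real MeasureTheory

/-- The kernel `|t| ^ s` is integrable near the origin for `s > -1`. -/
lemma integrableOn_abs_rpow_Icc {s : ℝ} (hs : -1 < s) :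
    IntegrableOn (fun t : ℝ => |t| ^ s) (Set.Icc (-1) 1) := by
  have h1 : IntegrableOn (fun t : ℝ => |t| ^ s) (Set.Ioc 0 1) := by
    have h := (intervalIntegrable_iff_integrableOn_Ioc_of_le (zero_le_one' ℝ)).1
      (intervalIntegral.intervalIntegrable_rpow' (a := 0) (b := 1) hs)
    exact h.congr_fun (fun t ht => by simp only [abs_of_pos ht.1]) measurableSet_Ioc
  have h2 : IntegrableOn (fun t : ℝ => |t| ^ s) (Set.Ico (-1) 0) := by
    have h := h1.comp_neg
    simpa using h
  have h3 : IntegrableOn (fun t : ℝ => |t| ^ s) {0} :=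
    integrableOn_singleton (hx := by rw [Real.volume_singleton]; exact ENNReal.zero_lt_top)
  refine ((h2.union h3).union h1).mono_set fun t ht => ?_
  rcases lt_trichotomy t 0 with h | h | h
  · exact Or.inl (Or.inl ⟨ht.1, h⟩)
  · exact Or.inl (Or.inr h)
  · exact Or.inr ⟨h, ht.2⟩

/-- The exponentially weighted kernel `|u - v| ^ s` is integrable on the open quadrant. -/
lemma integrableOn_exp_mul_exp_mul_abs_sub_rpow {α s : ℝ} (hα : 0 < α) (hs : -1 < s)
    (hs0 : s ≤ 0) :
    IntegrableOn (fun p : ℝ × ℝ => exp (-α * p.1) * exp (-α * p.2) * |p.1 - p.2| ^ s)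
      (Set.Ioi (0 : ℝ) ×ˢ Set.Ioi (0 : ℝ)) := by
  have he : IntegrableOn (fun t : ℝ => exp (-α * t)) (Set.Ioi 0) :=
    exp_neg_integrableOn_Ioi 0 hα
  have hf := he.integrable_indicator measurableSet_Ioi
  have hg := (integrableOn_abs_rpow_Icc hs).integrable_indicator measurableSet_Icc
  have hA := hf.mul_prod hf
  have hB := hf.convolution_integrand (ContinuousLinearMap.mul ℝ ℝ) hg
  refine (hA.add hB).integrableOn.mono' ?_ ?_
  · exact Measurable.aestronglyMeasurable (by fun_prop)
  · refine (ae_restrict_iff' (measurableSet_Ioi.prod measurableSet_Ioi)).2 (.of_forall ?_)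
    rintro ⟨u, v⟩ ⟨hu, hv⟩
    simp only [Set.mem_Ioi] at hu hv
    have hu1 : exp (-α * u) ≤ 1 := exp_le_one_iff.2 (by nlinarith)
    have hk : 0 ≤ |u - v| ^ s := by positivity
    rw [norm_of_nonneg (by positivity)]
    simp only [Pi.add_apply, ContinuousLinearMap.mul_apply',
      Set.indicator_of_mem (Set.mem_Ioi.2 hu), Set.indicator_of_mem (Set.mem_Ioi.2 hv)]
    by_cases h : u - v ∈ Set.Icc (-1 : ℝ) 1
    · rw [Set.indicator_of_mem h]
      have h1 : exp (-α * u) * (exp (-α * v) * |u - v| ^ s) ≤ exp (-α * v) * |u - v| ^ s :=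
        mul_le_of_le_one_left (by positivity) hu1
      have h2 : 0 ≤ exp (-α * u) * exp (-α * v) := by positivity
      linarith
    · rw [Set.indicator_of_notMem h, mul_zero, add_zero]
      refine mul_le_of_le_one_right (by positivity) (rpow_le_one_of_one_le_of_nonpos ?_ hs0)
      by_contra hlt
      exact h (abs_le.1 (not_le.1 hlt).le)

theorem exp_minus_one_double_integral_bound (α H : ℝ) (hα : 0 < α)
    (hH : H ∈ Set.Ioo (1/2 : ℝ) 1) :
    (∀ n : ℝ, 0 < n →
        Real.exp (-2 * α * n) *
            (∫ u in (0:ℝ)..n, ∫ v in (0:ℝ)..n,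
              (Real.exp (α * u) - 1) * (Real.exp (α * v) - 1) * |u - v| ^ (2 * H - 2))
          ≤ ∫ p in Set.Ioi (0:ℝ) ×ˢ Set.Ioi (0:ℝ),
              Real.exp (-α * p.1) * Real.exp (-α * p.2) * |p.1 - p.2| ^ (2 * H - 2)) ∧
      IntegrableOn
        (fun p : ℝ × ℝ =>
          Real.exp (-α * p.1) * Real.exp (-α * p.2) * |p.1 - p.2| ^ (2 * H - 2))
        (Set.Ioi (0:ℝ) ×ˢ Set.Ioi (0:ℝ)) := by
  obtain ⟨hH1, hH2⟩ := hH
  have hF := integrableOn_exp_mul_exp_mul_abs_sub_rpow (s := 2 * H - 2) hα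
    (by linarith) (by linarith)
  refine ⟨fun n hn => ?_, hF⟩
  set s := 2 * H - 2
  set F : ℝ × ℝ → ℝ := fun p => exp (-α * p.1) * exp (-α * p.2) * |p.1 - p.2| ^ s with hFdef
  let G : ℝ × ℝ → ℝ := fun p =>
    (exp (-α * p.1) - exp (-α * n)) * (exp (-α * p.2) - exp (-α * n)) * |p.1 - p.2| ^ s
  have hsub : Set.Ioc 0 n ×ˢ Set.Ioc 0 n ⊆ Set.Ioi (0 : ℝ) ×ˢ Set.Ioi (0 : ℝ) :=
    Set.prod_mono Set.Ioc_subset_Ioi_self Set.Ioc_subset_Ioi_self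
  have hmeas : MeasurableSet (Set.Ioc 0 n ×ˢ Set.Ioc 0 n) :=
    measurableSet_Ioc.prod measurableSet_Ioc
  have hF' : IntegrableOn F (Set.Ioc 0 n ×ˢ Set.Ioc 0 n) := hF.mono_set hsub
  have hGF : ∀ p ∈ Set.Ioc 0 n ×ˢ Set.Ioc 0 n, 0 ≤ G p ∧ G p ≤ F p := by
    rintro ⟨u, v⟩ ⟨hu, hv⟩
    have hexp : ∀ w ∈ Set.Ioc 0 n, 0 ≤ exp (-α * w) - exp (-α * n) := fun w hw =>
      sub_nonneg.2 (exp_le_exp.2 (by nlinarith [hw.2]))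
    have hn0 := exp_pos (-α * n)
    have hu0 := hexp u hu
    have hv0 := hexp v hv
    have hk : 0 ≤ |u - v| ^ s := by positivity
    refine ⟨mul_nonneg (mul_nonneg hu0 hv0) hk, mul_le_mul_of_nonneg_right ?_ hk⟩
    exact mul_le_mul (by linarith) (by linarith) hv0 (exp_pos _).le
  have hG : IntegrableOn G (Set.Ioc 0 n ×ˢ Set.Ioc 0 n) := by
    refine hF'.mono' (Measurable.aestronglyMeasurable (by fun_prop)) ?_
    refine (ae_restrict_iff' hmeas).2 (.of_forall fun p hp => ?_)
    rw [norm_of_nonneg (hGF p hp).1]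
    exact (hGF p hp).2
  have hreflect : exp (-2 * α * n) * (∫ u in (0:ℝ)..n, ∫ v in (0:ℝ)..n,
      (exp (α * u) - 1) * (exp (α * v) - 1) * |u - v| ^ s)
      = ∫ u in (0:ℝ)..n, ∫ v in (0:ℝ)..n, G (u, v) := by
    have hinner : ∀ u : ℝ, (∫ v in (0:ℝ)..n, G (u, v)) = exp (-2 * α * n) *
        ∫ v in (0:ℝ)..n, (exp (α * (n - u)) - 1) * (exp (α * v) - 1) * |n - u - v| ^ s := by
      intro u
      have h := intervalIntegral.integral_comp_sub_left (a := 0) (b := n)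
        (fun v => (exp (α * (n - u)) - 1) * (exp (α * v) - 1) * |n - u - v| ^ s) n
      rw [sub_self, sub_zero] at h
      rw [← h, ← intervalIntegral.integral_const_mul]
      congr 1 with v
      have hexp : ∀ w, exp (-α * w) - exp (-α * n)
          = exp (-α * n) * (exp (α * (n - w)) - 1) := fun w => by
        rw [mul_sub, ← exp_add, mul_one]; ring_nf
      have hnn : exp (-2 * α * n) = exp (-α * n) * exp (-α * n) := by
        rw [← exp_add]; ring_nf
      have habs : |n - u - (n - v)| = |u - v| := by
        rw [abs_sub_comm u v]; ring_nf
      simp only [G, hexp, hnn, habs]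
      ring
    simp only [hinner]
    rw [intervalIntegral.integral_const_mul]
    have h := intervalIntegral.integral_comp_sub_left (a := 0) (b := n)
      (fun u => ∫ v in (0:ℝ)..n, (exp (α * u) - 1) * (exp (α * v) - 1) * |u - v| ^ s) n
    rw [sub_self, sub_zero] at h
    rw [← h]
  calc _ = ∫ u in (0:ℝ)..n, ∫ v in (0:ℝ)..n, G (u, v) := hreflect
    _ = ∫ p in Set.Ioc 0 n ×ˢ Set.Ioc 0 n, G p := by
        simp only [intervalIntegral.integral_of_le hn.le]
        exact (setIntegral_prod G hG).symm
    _ ≤ ∫ p in Set.Ioc 0 n ×ˢ Set.Ioc 0 n, F p :=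
        setIntegral_mono_on hG hF' hmeas fun p hp => (hGF p hp).2
    _ ≤ _ := setIntegral_mono_set hF (.of_forall fun p => by simp only [hFdef]; positivity)
        hsub.eventuallyLE
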